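/- Fix ε, r ∈ (0,1). Let f₁ : ℂ → ℂ be entire, let A ∈ ℂ, and let F(ζ) = A/(1−ζ) + f₁(ζ)·log(1−ζ)/(2πi), holomorphic on the unit disk, with Taylor coefficients (a_n)_{n≥0} at 0. Let U = {ζ ∈ ℂ : |ζ| < 1+ε} ∖ [1, 1+ε) and let g : U → ℂ be holomorphic, with Taylor coefficients (b_n)_{n≥0} at 0, and suppose there exist B ∈ ℂ and functions g₁, g₂ holomorphic on the disk D(1,r) such that g(ζ) = B/(1−ζ) + g₁(ζ)·log(1−ζ)/(2πi) + g₂(ζ) for all ζ ∈ D(1,r) with ζ ∉ [1,∞). Then the Hadamard product series h(ζ) = Σ_{n≥0} a_n b_n ζ^n converges for |ζ| < 1 and lim_{ζ→1⁻, ζ∈(0,1)} (1−ζ)·h(ζ) = A·B. Consequently, if h(ζ) = 1/(1−ζ) for all |ζ| < 1 (i.e. g is the Hadamard inverse of F), then A·B = 1. -/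

import Mathlib

open Metric Complex Filter

/-- Cauchy's estimate for the coefficients of a power series converging on the unit disk. -/
theorem norm_coeff_mul_pow_le_of_hasSum {u : ℕ → ℂ} {F : ℂ → ℂ}
    (hF : ∀ ζ : ℂ, ‖ζ‖ < 1 → HasSum (fun n => u n * ζ ^ n) (F ζ))
    {ρ M : ℝ} (hρ : 0 < ρ) (hρ1 : ρ < 1) (hM : ∀ ζ : ℂ, ‖ζ‖ = ρ → ‖F ζ‖ ≤ M) (n : ℕ) :
    ‖u n‖ * ρ ^ n ≤ M := by
  have hp : HasFPowerSeriesOnBall F (FormalMultilinearSeries.ofScalars ℂ u) 0 1 := by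
    refine ⟨?_, one_pos, ?_⟩
    · refine ENNReal.le_of_forall_nnreal_lt fun s hs => ?_
      refine FormalMultilinearSeries.le_radius_of_summable _ ?_
      have hs1 : ‖((s : ℝ) : ℂ)‖ < 1 := by simpa using hs
      simpa using (hF _ hs1).summable.norm
    · intro y hy
      have hy1 : ‖y‖ < 1 := by simpa [enorm_eq_nnnorm, ← NNReal.coe_lt_one] using hy
      simpa [FormalMultilinearSeries.ofScalars_apply_eq, mul_comm] using hF y hy1
  have hd : DiffContOnCl ℂ F (ball 0 ρ) := by
    refine DifferentiableOn.diffContOnCl (hp.differentiableOn.mono ?_)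
    rw [closure_ball _ hρ.ne']
    intro z hz
    have hz1 : ‖z‖ < 1 := (mem_closedBall_zero_iff.1 hz).trans_lt hρ1
    simpa [enorm_eq_nnnorm, ← NNReal.coe_lt_one] using hz1
  have h1 := Complex.norm_iteratedDeriv_le_of_forall_mem_sphere_norm_le n hρ hd
    (fun z hz => hM z (mem_sphere_zero_iff_norm.1 hz))
  have h2 := hp.factorial_smul 1 n
  rw [← iteratedDeriv_eq_iteratedFDeriv, FormalMultilinearSeries.ofScalars_apply_eq] at h2
  rw [← h2] at h1
  have hn : (0 : ℝ) < n.factorial := by positivity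
  simp only [one_pow, smul_eq_mul, mul_one, nsmul_eq_mul, norm_mul, Complex.norm_natCast] at h1
  rw [mul_div_assoc] at h1
  rw [← le_div_iff₀ (by positivity)]
  exact le_of_mul_le_mul_left h1 hn

/-- A power series on the unit disk determines its coefficients. -/
theorem coeff_eq_of_hasSum {u v : ℕ → ℂ} {F : ℂ → ℂ}
    (hu : ∀ ζ : ℂ, ‖ζ‖ < 1 → HasSum (fun n => u n * ζ ^ n) (F ζ))
    (hv : ∀ ζ : ℂ, ‖ζ‖ < 1 → HasSum (fun n => v n * ζ ^ n) (F ζ)) : u = v := by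
  funext n
  have h := norm_coeff_mul_pow_le_of_hasSum (u := fun n => u n - v n) (F := fun _ => 0)
    (fun ζ hζ => by simpa [sub_mul] using (hu ζ hζ).sub (hv ζ hζ))
    (ρ := 1 / 2) (M := 0) (by norm_num) (by norm_num) (by simp) n
  have h2 : (0 : ℝ) < (1 / 2) ^ n := by positivity
  have h3 : ‖u n - v n‖ ≤ 0 := by nlinarith
  exact sub_eq_zero.1 (norm_le_zero_iff.1 h3)

/-- If `w n → 0`, then `(1 - x) ∑ w n x ^ n → 0` as `x → 1⁻`. -/
theorem tendsto_one_sub_mul_tsum_zero {w : ℕ → ℂ} (hw : Tendsto w atTop (nhds 0))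
    (hs : ∀ x ∈ Set.Ioo (0 : ℝ) 1, Summable fun n => w n * (x : ℂ) ^ n) :
    Tendsto (fun x : ℝ => (1 - (x : ℂ)) * ∑' n, w n * (x : ℂ) ^ n)
      (nhdsWithin 1 (Set.Ioo (0 : ℝ) 1)) (nhds 0) := by
  set v : ℕ → ℂ := fun n => w n - if n = 0 then 0 else w (n - 1) with hv
  have hpart : ∀ n, ∑ i ∈ Finset.range (n + 1), v i = w n := by
    intro n
    induction n with
    | zero => simp [hv]
    | succ n ih => rw [Finset.sum_range_succ, ih]; simp [hv]
  have hlim : Tendsto (fun n => ∑ i ∈ Finset.range n, v i) atTop (nhds 0) := by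
    rw [← tendsto_add_atTop_iff_nat 1]
    simpa only [hpart] using hw
  have habel := Complex.tendsto_tsum_powerSeries_nhdsWithin_lt hlim
  rw [tendsto_map'_iff] at habel
  refine (habel.mono_left (nhdsWithin_mono _ fun x hx => hx.2)).congr' ?_
  filter_upwards [self_mem_nhdsWithin] with x hx
  have hsx := hs x hx
  have hshift : HasSum (fun n => (if n = 0 then 0 else w (n - 1)) * (x : ℂ) ^ n)
      ((x : ℂ) * ∑' n, w n * (x : ℂ) ^ n) := by
    rw [← hasSum_nat_add_iff' 1]
    simpa using (hsx.hasSum.mul_left (x : ℂ)).congr_fun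
      (g := fun n => w n * (x : ℂ) ^ (n + 1)) fun n => by ring
  have := hsx.hasSum.sub hshift
  simp only [← sub_mul] at this
  simp only [Function.comp_apply, hv]
  rw [this.tsum_eq]
  ring

/-- The coefficients of `f(ζ) log(1 - ζ)` with `f` entire are `O(1/n)`. -/
theorem exists_coeff_mul_log_of_entire {f : ℂ → ℂ} (hf : Differentiable ℂ f) :
    ∃ (c : ℕ → ℂ) (C : ℝ), (∀ n, n * ‖c n‖ ≤ C) ∧
      ∀ ζ : ℂ, ‖ζ‖ < 1 → HasSum (fun n => c n * ζ ^ n) (f ζ * Complex.log (1 - ζ)) := by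
  set p : ℕ → ℂ := fun n => (n.factorial : ℂ)⁻¹ * iteratedDeriv n f 0 with hp
  have hpsum : ∀ ζ : ℂ, HasSum (fun n => p n * ζ ^ n) (f ζ) := by
    intro ζ
    refine (Complex.hasSum_taylorSeries_of_entire hf 0 ζ).congr_fun fun n => ?_
    simp only [hp, sub_zero, smul_eq_mul]
    ring
  have hqsum : ∀ ζ : ℂ, ‖ζ‖ < 1 →
      HasSum (fun n : ℕ => -(n : ℂ)⁻¹ * ζ ^ n) (Complex.log (1 - ζ)) := by
    intro ζ hζ
    have h := (Complex.hasSum_taylorSeries_neg_log hζ).neg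
    rw [neg_neg] at h
    exact h.congr_fun fun n => by ring
  have hpn : Summable fun n => ‖p n‖ * (n + 1) := by
    refine Summable.of_nonneg_of_le (fun n => by positivity) (fun n => ?_) (hpsum 2).summable.norm
    rw [norm_mul (p n), norm_pow, Complex.norm_ofNat]
    gcongr
    exact_mod_cast Nat.lt_two_pow_self
  refine ⟨fun n => ∑ kl ∈ Finset.HasAntidiagonal.antidiagonal n, p kl.1 * -(kl.2 : ℂ)⁻¹,
    ∑' n, ‖p n‖ * (n + 1), fun n => ?_, fun ζ hζ => ?_⟩
  · calc n * ‖∑ kl ∈ Finset.HasAntidiagonal.antidiagonal n, p kl.1 * -(kl.2 : ℂ)⁻¹‖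
        ≤ n * ∑ kl ∈ Finset.HasAntidiagonal.antidiagonal n, ‖p kl.1‖ * (kl.2 : ℝ)⁻¹ := by
          gcongr
          refine (norm_sum_le _ _).trans (le_of_eq ?_)
          simp
      _ ≤ ∑ kl ∈ Finset.HasAntidiagonal.antidiagonal n, ‖p kl.1‖ * (kl.1 + 1) := by
          rw [Finset.mul_sum]
          refine Finset.sum_le_sum fun kl hkl => ?_
          rw [Finset.HasAntidiagonal.mem_antidiagonal] at hkl
          rw [mul_left_comm]
          gcongr
          rcases Nat.eq_zero_or_pos kl.2 with h | h
          · simp only [h, Nat.cast_zero, inv_zero, mul_zero]; positivity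
          · have h1 : (1 : ℝ) ≤ kl.2 := by exact_mod_cast h
            rw [← hkl, ← div_eq_mul_inv, div_le_iff₀ (by positivity)]
            push_cast
            nlinarith [(Nat.cast_nonneg kl.1 : (0 : ℝ) ≤ kl.1)]
      _ = ∑ k ∈ Finset.range (n + 1), ‖p k‖ * (k + 1) :=
          Finset.Nat.sum_antidiagonal_eq_sum_range_succ_mk _ _
      _ ≤ _ := hpn.sum_le_tsum _ fun k _ => by positivity
  · have h1 := (hpsum ζ).summable.norm
    have h2 := (hqsum ζ hζ).summable.norm
    have h3 := tsum_mul_tsum_eq_tsum_sum_antidiagonal_of_summable_norm h1 h2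
    have h4 := (summable_norm_sum_mul_antidiagonal_of_summable_norm h1 h2).of_norm.hasSum
    rw [← h3, (hpsum ζ).tsum_eq, (hqsum ζ hζ).tsum_eq] at h4
    refine h4.congr_fun fun n => ?_
    rw [Finset.sum_mul]
    refine Finset.sum_congr rfl fun kl hkl => ?_
    rw [← Finset.HasAntidiagonal.mem_antidiagonal.1 hkl, pow_add]
    ring

/-- If `(1 - ζ) G(ζ)` agrees on the disk with a function `P` continuous on the closed disk and
vanishing at `1`, then the Taylor coefficients of `G` are `o(n)`. -/
theorem tendsto_coeff_div_of_continuousOn {d : ℕ → ℂ} {G P : ℂ → ℂ}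
    (hG : ∀ ζ : ℂ, ‖ζ‖ < 1 → HasSum (fun n => d n * ζ ^ n) (G ζ))
    (hP : ContinuousOn P (closedBall 0 1)) (hP1 : P 1 = 0)
    (hPG : ∀ ζ : ℂ, ‖ζ‖ < 1 → P ζ = (1 - ζ) * G ζ) :
    Tendsto (fun n : ℕ => ‖d n‖ / (n + 1)) atTop (nhds 0) := by
  obtain ⟨M, hM⟩ := (isCompact_closedBall (0 : ℂ) 1).exists_bound_of_continuousOn hP
  have hM0 : 0 ≤ M := (norm_nonneg _).trans (hM 0 (by simp))
  rw [Metric.tendsto_atTop]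
  intro e he
  obtain ⟨δ, hδ, hδP⟩ := Metric.continuousOn_iff.1 hP 1 (by simp) (e / 8) (by positivity)
  obtain ⟨N, hN⟩ := exists_nat_gt (8 * (M / δ) / e)
  refine ⟨N, fun n hn => ?_⟩
  have hn1 : (0 : ℝ) < n + 1 := by positivity
  set t : ℝ := 1 / (2 * (n + 1)) with ht
  have ht0 : 0 < t := by positivity
  have htn : t * (n + 1) = 1 / 2 := by rw [ht]; field_simp
  have ht1 : t ≤ 1 / 2 := by nlinarith [(Nat.cast_nonneg n : (0 : ℝ) ≤ n)]
  have hbound : ∀ ζ : ℂ, ‖ζ‖ = 1 - t → ‖G ζ‖ ≤ e / 8 / t + M / δ := by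
    intro ζ hζ
    have hζ1 : ‖ζ‖ < 1 := by linarith
    have hmem : ζ ∈ closedBall (0 : ℂ) 1 := by simpa using hζ1.le
    have hdist : t ≤ ‖1 - ζ‖ := by
      have := norm_sub_norm_le (1 : ℂ) ζ
      rw [norm_one, hζ] at this
      linarith
    have hnorm : ‖P ζ‖ = ‖1 - ζ‖ * ‖G ζ‖ := by rw [hPG ζ hζ1, norm_mul]
    rcases lt_or_ge ‖1 - ζ‖ δ with h | h
    · have h1 := hδP ζ hmem (by rwa [dist_comm, dist_eq_norm])
      rw [hP1, dist_zero_right, hnorm] at h1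
      have : ‖G ζ‖ ≤ e / 8 / t := by
        rw [le_div_iff₀ ht0]
        nlinarith [norm_nonneg (G ζ)]
      have : 0 ≤ M / δ := by positivity
      linarith
    · have h1 := hM ζ hmem
      rw [hnorm] at h1
      have : ‖G ζ‖ ≤ M / δ := by
        rw [le_div_iff₀ hδ]
        nlinarith [norm_nonneg (G ζ)]
      have : 0 ≤ e / 8 / t := by positivity
      linarith
  have hc := norm_coeff_mul_pow_le_of_hasSum hG (by linarith) (by linarith) hbound n
  have hb := one_add_mul_le_pow (a := -t) (by linarith) n
  have hpow : 1 / 2 ≤ (1 - t) ^ n := by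
    rw [← sub_eq_add_neg] at hb
    nlinarith
  have het : e / 8 / t = e / 4 * (n + 1) := by rw [ht]; field_simp; ring
  rw [het] at hc
  have hNn : 8 * (M / δ) < e * (n + 1) := by
    have : (N : ℝ) ≤ n := by exact_mod_cast hn
    rw [div_lt_iff₀ he] at hN
    nlinarith
  rw [Real.dist_eq, sub_zero, abs_of_nonneg (by positivity), div_lt_iff₀ hn1]
  nlinarith [norm_nonneg (d n)]

theorem tendsto_mul_log_zero :
    Tendsto (fun z : ℂ => z * Complex.log z) (nhds 0) (nhds 0) := by
  have h : Tendsto (fun z : ℂ => |‖z‖ * Real.log ‖z‖| + ‖z‖ * Real.pi) (nhds 0) (nhds 0) := by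
    have hc : Continuous fun z : ℂ => |‖z‖ * Real.log ‖z‖| + ‖z‖ * Real.pi :=
      (Real.continuous_mul_log.comp continuous_norm).abs.add (by fun_prop)
    simpa using hc.tendsto 0
  refine squeeze_zero_norm (fun z => ?_) h
  rw [norm_mul, abs_mul, abs_norm, ← mul_add]
  gcongr
  refine (Complex.norm_le_abs_re_add_abs_im _).trans ?_
  rw [Complex.log_re, Complex.log_im]
  gcongr
  exact Complex.abs_arg_le_pi z

/-- If `F(ζ) = A/(1−ζ) + f₁(ζ)log(1−ζ)/(2πi)` and `g` has a simple singularity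
`B/(1−ζ) + g₁(ζ)log(1−ζ)/(2πi) + g₂(ζ)` at `1`, then `(1−ζ)(F ⊙ g)(ζ) → A·B` as `ζ → 1⁻`;
in particular, if `g` is the Hadamard inverse of `F` then `A·B = 1`. -/
theorem stmt11 (ε r : ℝ) (hε : ε ∈ Set.Ioo (0 : ℝ) 1) (hr : r ∈ Set.Ioo (0 : ℝ) 1)
    (f₁ : ℂ → ℂ) (hf₁ : Differentiable ℂ f₁) (A : ℂ)
    (a : ℕ → ℂ)
    (ha : ∀ ζ : ℂ, ‖ζ‖ < 1 → HasSum (fun n => a n * ζ ^ n)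
      (A / (1 - ζ) + f₁ ζ * Complex.log (1 - ζ) / (2 * Real.pi * I)))
    (U : Set ℂ) (hU : U = ball (0 : ℂ) (1 + ε) \ (Complex.ofReal '' Set.Ico 1 (1 + ε)))
    (g : ℂ → ℂ) (hg : DifferentiableOn ℂ g U)
    (b : ℕ → ℂ) (hb : ∀ ζ : ℂ, ‖ζ‖ < 1 → HasSum (fun n => b n * ζ ^ n) (g ζ))
    (B : ℂ) (g₁ g₂ : ℂ → ℂ)
    (hg₁ : DifferentiableOn ℂ g₁ (ball (1 : ℂ) r))
    (hg₂ : DifferentiableOn ℂ g₂ (ball (1 : ℂ) r))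
    (hrep : ∀ ζ ∈ ball (1 : ℂ) r, ζ ∈ U → ζ ∉ Complex.ofReal '' Set.Ici 1 →
      g ζ = B / (1 - ζ) + g₁ ζ * Complex.log (1 - ζ) / (2 * Real.pi * I) + g₂ ζ) :
    (∀ ζ : ℂ, ‖ζ‖ < 1 → Summable (fun n => a n * b n * ζ ^ n)) ∧
    Tendsto (fun x : ℝ => (1 - (x : ℂ)) * ∑' n, a n * b n * (x : ℂ) ^ n)
      (nhdsWithin 1 (Set.Ioo (0 : ℝ) 1)) (nhds (A * B)) ∧
    ((∀ ζ : ℂ, ‖ζ‖ < 1 → ∑' n, a n * b n * ζ ^ n = 1 / (1 - ζ)) → A * B = 1) := by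
  have hpole : ∀ ζ : ℂ, ‖ζ‖ ≤ 1 → ζ ∈ Complex.ofReal '' Set.Ici 1 → ζ = 1 := by
    rintro _ h ⟨x, hx, rfl⟩
    rw [Complex.norm_real, Real.norm_eq_abs] at h
    have : x = 1 := le_antisymm ((le_abs_self x).trans h) hx
    simp [this]
  have hUmem : ∀ ζ : ℂ, ‖ζ‖ ≤ 1 → ζ ≠ 1 → ζ ∈ U := by
    intro ζ h h1
    rw [hU]
    refine ⟨by simpa using h.trans_lt (by linarith [hε.1]), fun hmem => h1 (hpole ζ h ?_)⟩
    exact Set.image_mono Set.Ico_subset_Ici_self hmem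
  have hUnhds : ∀ ζ : ℂ, ‖ζ‖ ≤ 1 → ζ ≠ 1 → U ∈ nhds ζ := by
    intro ζ h h1
    have hcl : IsClosed (Complex.ofReal '' Set.Ici 1) :=
      Complex.isometry_ofReal.isClosedEmbedding.isClosedMap _ isClosed_Ici
    have hopen : ball (0 : ℂ) (1 + ε) \ (Complex.ofReal '' Set.Ici 1) ∈ nhds ζ := by
      refine (isOpen_ball.sdiff hcl).mem_nhds ⟨?_, fun hm => h1 (hpole ζ h hm)⟩
      simpa using h.trans_lt (by linarith [hε.1])
    rw [hU]
    exact mem_of_superset hopen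
      (Set.sdiff_subset_sdiff_right (Set.image_mono Set.Ico_subset_Ici_self))
  set P : ℂ → ℂ := fun ζ => (1 - ζ) * (g ζ - B / (1 - ζ)) with hPdef
  have hP1 : P 1 = 0 := by simp [hPdef]
  have hP : ContinuousOn P (closedBall 0 1) := by
    intro ζ hζ
    have hζ1 : ‖ζ‖ ≤ 1 := by simpa using hζ
    by_cases h1 : ζ = 1
    · subst h1
      have hb1 : ball (1 : ℂ) r ∈ nhds 1 := ball_mem_nhds _ hr.1
      have hc₁ := (hg₁.differentiableAt hb1).continuousAt
      have hc₂ := (hg₂.differentiableAt hb1).continuousAt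
      have hsub : Tendsto (fun ζ : ℂ => 1 - ζ) (nhds 1) (nhds 0) := by
        have : Continuous fun ζ : ℂ => 1 - ζ := by fun_prop
        simpa using this.tendsto 1
      have hlim : Tendsto (fun ζ : ℂ => g₁ ζ * ((1 - ζ) * Complex.log (1 - ζ)) / (2 * Real.pi * I)
          + (1 - ζ) * g₂ ζ) (nhds 1) (nhds (P 1)) := by
        simpa [hP1] using
          ((hc₁.tendsto.mul (tendsto_mul_log_zero.comp hsub)).div_const (2 * Real.pi * I)).add
            (hsub.mul hc₂.tendsto)
      refine (hlim.mono_left nhdsWithin_le_nhds).congr' ?_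
      filter_upwards [self_mem_nhdsWithin, nhdsWithin_le_nhds hb1] with z hz hzr
      have hz1 : ‖z‖ ≤ 1 := by simpa using hz
      by_cases hz0 : z = 1
      · simp [hz0, hPdef]
      · simp only [hPdef]
        rw [hrep z hzr (hUmem z hz1 hz0) fun hm => hz0 (hpole z hz1 hm)]
        ring
    · have hne : 1 - ζ ≠ 0 := sub_ne_zero.2 (Ne.symm h1)
      have hgc := (hg.differentiableAt (hUnhds ζ hζ1 h1)).continuousAt
      have hsub : ContinuousAt (fun z : ℂ => 1 - z) ζ := by fun_prop
      exact (hsub.mul (hgc.sub (continuousAt_const.div hsub hne))).continuousWithinAt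
  have hgeom : ∀ (K ζ : ℂ), ‖ζ‖ < 1 → HasSum (fun n => K * ζ ^ n) (K / (1 - ζ)) :=
    fun K ζ hζ => (hasSum_geometric_of_norm_lt_one hζ).mul_left K
  have hd := tendsto_coeff_div_of_continuousOn (d := fun n => b n - B)
    (G := fun ζ => g ζ - B / (1 - ζ))
    (fun ζ hζ => by simpa only [sub_mul] using (hb ζ hζ).sub (hgeom B ζ hζ)) hP hP1
    (fun ζ _ => rfl)
  obtain ⟨c, C, hC, hc⟩ := exists_coeff_mul_log_of_entire (hf₁.div_const (2 * Real.pi * I))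
  have hac : a = fun n => A + c n := by
    refine coeff_eq_of_hasSum ha fun ζ hζ => ?_
    have := (hgeom A ζ hζ).add (hc ζ hζ)
    simp only [← add_mul] at this
    convert this using 2
    ring
  have hC' : ∀ n : ℕ, (n + 1) * ‖c n‖ ≤ C + (C + ‖c 0‖) := by
    intro n
    have h0 : 0 ≤ C := by simpa using hC 0
    rcases Nat.eq_zero_or_pos n with rfl | hn
    · simp; linarith
    · have h1 : (1 : ℝ) ≤ n := by exact_mod_cast hn
      nlinarith [hC n, norm_nonneg (c n), norm_nonneg (c 0)]
  set D : ℝ := C + (C + ‖c 0‖)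
  have hcb : ∀ n, ‖c n‖ ≤ D := fun n => by
    nlinarith [hC' n, norm_nonneg (c n), (Nat.cast_nonneg n : (0 : ℝ) ≤ n)]
  have hc0 : Tendsto c atTop (nhds 0) := by
    refine squeeze_zero_norm (fun n => ?_)
      (by simpa using tendsto_one_div_add_atTop_nhds_zero_nat.const_mul D)
    rw [← div_eq_mul_inv, le_div_iff₀ (by positivity), mul_comm]
    exact hC' n
  have hcd : Tendsto (fun n => c n * (b n - B)) atTop (nhds 0) := by
    refine squeeze_zero_norm (fun n => ?_) (by simpa using hd.const_mul D)
    rw [norm_mul, ← mul_div_assoc, le_div_iff₀ (by positivity)]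
    nlinarith [mul_le_mul_of_nonneg_right (hC' n) (norm_nonneg (b n - B))]
  have hcb0 : Tendsto (fun n => c n * b n) atTop (nhds 0) := by
    have := hcd.add (hc0.mul_const B)
    simp only [zero_mul, add_zero] at this
    exact this.congr fun n => by ring
  have hscb : ∀ ζ : ℂ, ‖ζ‖ < 1 → Summable fun n => c n * b n * ζ ^ n := by
    intro ζ hζ
    refine Summable.of_norm_bounded ((hb ζ hζ).summable.norm.mul_left D) fun n => ?_
    rw [mul_assoc, norm_mul]
    exact mul_le_mul_of_nonneg_right (hcb n) (norm_nonneg _)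
  have hsum : ∀ ζ : ℂ, ‖ζ‖ < 1 →
      HasSum (fun n => a n * b n * ζ ^ n) (A * g ζ + ∑' n, c n * b n * ζ ^ n) := by
    intro ζ hζ
    refine (((hb ζ hζ).mul_left A).add (hscb ζ hζ).hasSum).congr_fun fun n => ?_
    rw [hac]
    ring
  have hnorm : ∀ x ∈ Set.Ioo (0 : ℝ) 1, ‖(x : ℂ)‖ < 1 := fun x hx => by
    rw [Complex.norm_real, Real.norm_eq_abs, abs_of_pos hx.1]
    exact hx.2
  have hne : ∀ x ∈ Set.Ioo (0 : ℝ) 1, 1 - (x : ℂ) ≠ 0 := fun x hx h =>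
    hx.2.ne (by exact_mod_cast (sub_eq_zero.1 h).symm)
  have hPlim : Tendsto (fun x : ℝ => P x) (nhdsWithin 1 (Set.Ioo (0 : ℝ) 1)) (nhds 0) := by
    have h1 : Tendsto P (nhdsWithin 1 (closedBall 0 1)) (nhds 0) := by
      have := hP 1 (by simp)
      rwa [ContinuousWithinAt, hP1] at this
    refine h1.comp (tendsto_nhdsWithin_iff.2 ⟨?_, ?_⟩)
    · have := Complex.continuous_ofReal.tendsto 1
      rw [Complex.ofReal_one] at this
      exact this.mono_left nhdsWithin_le_nhds
    · filter_upwards [self_mem_nhdsWithin] with x hx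
      simpa using (hnorm x hx).le
  have hmain : Tendsto (fun x : ℝ => (1 - (x : ℂ)) * ∑' n, a n * b n * (x : ℂ) ^ n)
      (nhdsWithin 1 (Set.Ioo (0 : ℝ) 1)) (nhds (A * B)) := by
    have h := (hPlim.const_mul A).add
      (tendsto_one_sub_mul_tsum_zero hcb0 fun x hx => hscb x (hnorm x hx))
    have h' := h.const_add (A * B)
    simp only [mul_zero, add_zero] at h'
    refine h'.congr' ?_
    filter_upwards [self_mem_nhdsWithin] with x hx
    rw [(hsum x (hnorm x hx)).tsum_eq]
    have := hne x hx
    simp only [hPdef]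
    field_simp
    ring
  refine ⟨fun ζ hζ => (hsum ζ hζ).summable, hmain, fun h => ?_⟩
  have : (nhdsWithin (1 : ℝ) (Set.Ioo (0 : ℝ) 1)).NeBot := by
    rw [nhdsWithin_Ioo_eq_nhdsLT zero_lt_one]
    infer_instance
  refine tendsto_nhds_unique hmain (tendsto_const_nhds.congr' ?_)
  filter_upwards [self_mem_nhdsWithin] with x hx
  rw [h x (hnorm x hx), mul_one_div_cancel (hne x hx)]
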